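/- Let φ > 2 and let Ĝ be a graph with maximal spectral radius in Bl(k,φ). Then Ĝ is a block graph with a central cut vertex: Ĝ has exactly one cut vertex, and this vertex is contained in every block of Ĝ. -/

import Mathlib

namespace SpectralBlock

variable {V : Type*}

open Classical in
/-- The real adjacency matrix of a simple graph. -/
noncomputable def adjMat [Fintype V] (G : SimpleGraph V) : Matrix V V ℝ :=
  Matrix.of fun u v => if G.Adj u v then (1 : ℝ) else 0

/-- The spectral radius of a graph: the largest real eigenvalue of its adjacency matrix. -/
noncomputable def specRad [Fintype V] (G : SimpleGraph V) : ℝ :=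
  sSup {r : ℝ | ∃ x : V → ℝ, x ≠ 0 ∧ (adjMat G).mulVec x = r • x}

/-- A Perron vector of `G`: an entrywise positive eigenvector of the adjacency
matrix for the eigenvalue `specRad G`. -/
def IsPerron [Fintype V] (G : SimpleGraph V) (x : V → ℝ) : Prop :=
  (∀ v, 0 < x v) ∧ (adjMat G).mulVec x = specRad G • x

/-- A dissociation set: a set of vertices inducing a subgraph of maximum degree at most 1. -/
def IsDissoc (G : SimpleGraph V) (D : Set V) : Prop :=
  ∀ v ∈ D, (D ∩ {u | G.Adj v u}).ncard ≤ 1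

/-- The dissociation number: the maximum cardinality of a dissociation set. -/
noncomputable def dissocNum [Fintype V] (G : SimpleGraph V) : ℕ :=
  sSup {n : ℕ | ∃ D : Set V, IsDissoc G D ∧ D.ncard = n}

/-- A maximum dissociation set. -/
def IsMaxDissoc [Fintype V] (G : SimpleGraph V) (D : Set V) : Prop :=
  IsDissoc G D ∧ D.ncard = dissocNum G

/-- A cut vertex of a connected graph: a vertex whose removal disconnects the graph. -/
def IsCutVertex (G : SimpleGraph V) (v : V) : Prop :=
  G.Connected ∧ ¬ ((⊤ : G.Subgraph).deleteVerts {v}).coe.Connected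

/-- A block of a graph, viewed as a set of vertices: a maximal set inducing a
connected subgraph having no cut vertex of its own. -/
def IsBlock (G : SimpleGraph V) (B : Set V) : Prop :=
  (G.induce B).Connected ∧ (∀ v, ¬ IsCutVertex (G.induce B) v) ∧
    ∀ C : Set V, B ⊆ C → (G.induce C).Connected →
      (∀ v, ¬ IsCutVertex (G.induce C) v) → B = C

/-- A pendant block: a block containing at most one cut vertex of the graph. -/
def IsPendantBlock (G : SimpleGraph V) (B : Set V) : Prop :=
  IsBlock G B ∧ {v | v ∈ B ∧ IsCutVertex G v}.Subsingleton

/-- A block graph: a connected graph each of whose blocks is a complete graph. -/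
def IsBlockGraph (G : SimpleGraph V) : Prop :=
  G.Connected ∧ ∀ B : Set V, IsBlock G B → B.Pairwise G.Adj

/-- The class `Bl(k, φ)` of block graphs on `k` vertices with dissociation number `φ`. -/
def memBl (k φ : ℕ) (G : SimpleGraph (Fin k)) : Prop :=
  IsBlockGraph G ∧ dissocNum G = φ

/-- `G` has maximal spectral radius in the class `Bl(k, φ)`. -/
def MaxSpecIn (k φ : ℕ) (G : SimpleGraph (Fin k)) : Prop :=
  memBl k φ G ∧ ∀ H : SimpleGraph (Fin k), memBl k φ H → specRad H ≤ specRad G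

theorem conn_of_walks {G : SimpleGraph V} {s : Set V} (r : V) (hr : r ∈ s)
    (h : ∀ y ∈ s, ∃ p : G.Walk r y, ∀ z ∈ p.support, z ∈ s) : (G.induce s).Connected := by
  apply G.induce_connected_of_patches r hr
  intro y hy
  obtain ⟨p, hp⟩ := h y hy
  refine ⟨{z | z ∈ p.support}, fun z hz => hp z hz, p.start_mem_support, p.end_mem_support, ?_⟩
  exact p.connected_induce_support.preconnected _ _

theorem conn_of_dom {G : SimpleGraph V} {s : Set V} (c : V) (hc : c ∈ s)
    (h : ∀ y ∈ s, y ≠ c → G.Adj c y) : (G.induce s).Connected := by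
  apply conn_of_walks c hc
  intro y hy
  by_cases hyc : y = c
  · subst hyc
    exact ⟨SimpleGraph.Walk.nil, by simp [hy]⟩
  · exact ⟨(h y hy hyc).toWalk, by
      intro z hz
      simp at hz
      rcases hz with rfl | rfl <;> assumption⟩

/-- deleting a vertex of an induced subgraph -/
def delIso (G : SimpleGraph V) (B : Set V) (v : B) :
    ((⊤ : (G.induce B).Subgraph).deleteVerts {v}).coe ≃g G.induce (B \ {(v : V)}) where
  toFun x := ⟨x.1.1, x.1.2, by
    have h := x.2
    simp only [SimpleGraph.Subgraph.deleteVerts_verts, SimpleGraph.Subgraph.verts_top,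
      Set.mem_sdiff, Set.mem_univ, Set.mem_singleton_iff, true_and] at h
    exact fun h' => h (Subtype.ext h')⟩
  invFun x := ⟨⟨x.1, x.2.1⟩, by
    have h := x.2.2
    simp only [SimpleGraph.Subgraph.deleteVerts_verts, SimpleGraph.Subgraph.verts_top,
      Set.mem_sdiff, Set.mem_univ, Set.mem_singleton_iff, true_and]
    exact fun h' => h (by simpa using congrArg Subtype.val h')⟩
  left_inv x := rfl
  right_inv x := rfl
  map_rel_iff' := by
    rintro ⟨⟨a, ha⟩, ha'⟩ ⟨⟨b, hb⟩, hb'⟩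
    simp at ha' hb'
    simp [ha', hb']

def delIso' (G : SimpleGraph V) (v : V) :
    ((⊤ : G.Subgraph).deleteVerts {v}).coe ≃g G.induce ({v}ᶜ : Set V) where
  toFun x := ⟨x.1, by
    have h := x.2
    simp only [SimpleGraph.Subgraph.deleteVerts_verts, SimpleGraph.Subgraph.verts_top,
      Set.mem_sdiff, Set.mem_univ, Set.mem_singleton_iff, true_and] at h
    exact h⟩
  invFun x := ⟨x.1, by
    have h : (x : V) ≠ v := x.2
    simp [h]⟩
  left_inv x := rfl
  right_inv x := rfl
  map_rel_iff' := by
    rintro ⟨a, ha'⟩ ⟨b, hb'⟩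
    simp at ha' hb'
    simp [ha', hb']

theorem cut_iff (G : SimpleGraph V) (v : V) :
    IsCutVertex G v ↔ G.Connected ∧ ¬ (G.induce ({v}ᶜ : Set V)).Connected := by
  unfold IsCutVertex
  rw [(delIso' G v).connected_iff]

/-- connected without cut vertices -/
def Good (G : SimpleGraph V) (B : Set V) : Prop :=
  (G.induce B).Connected ∧ ∀ v ∈ B, (G.induce (B \ {v})).Connected

theorem good_iff (G : SimpleGraph V) (B : Set V) :
    Good G B ↔ (G.induce B).Connected ∧ (∀ v, ¬ IsCutVertex (G.induce B) v) := by
  unfold Good IsCutVertex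
  refine and_congr_right fun h => ?_
  constructor
  · intro h1 v h2
    exact h2.2 ((delIso G B v).connected_iff.2 (h1 v v.2))
  · intro h1 v hv
    have := h1 ⟨v, hv⟩
    simp only [h, true_and, not_not] at this
    exact (delIso G B ⟨v, hv⟩).connected_iff.1 this

theorem block_iff (G : SimpleGraph V) (B : Set V) :
    IsBlock G B ↔ Maximal (Good G) B := by
  unfold IsBlock
  rw [← and_assoc, ← good_iff]
  constructor
  · rintro ⟨h1, h2⟩
    refine ⟨h1, fun C hC hBC => ?_⟩
    have hC' := (good_iff G C).1 hC
    rw [← h2 C hBC hC'.1 hC'.2]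
  · rintro ⟨h1, h2⟩
    exact ⟨h1, fun C hBC h3 h4 => le_antisymm hBC (h2 ((good_iff G C).2 ⟨h3, h4⟩) hBC)⟩

theorem good_clique [Finite V] {G : SimpleGraph V} (hG : IsBlockGraph G) {B : Set V}
    (hB : Good G B) : B.Pairwise G.Adj := by
  obtain ⟨C, hBC, hC⟩ := (Set.toFinite {C | Good G C}).exists_le_maximal hB
  exact (hG.2 C ((block_iff G C).2 hC)).mono hBC

/-- Two neighbours of `w` joined by a walk avoiding `w` are adjacent. -/
theorem key_adj [Finite V] {G : SimpleGraph V} (hG : IsBlockGraph G) {u v w : V}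
    (hu : G.Adj w u) (hv : G.Adj w v) (huv : u ≠ v) (p : G.Walk u v) (hp : w ∉ p.support) :
    G.Adj u v := by
  classical
  obtain ⟨q, hq, hqs⟩ : ∃ q : G.Walk u v, q.IsPath ∧ w ∉ q.support :=
    ⟨p.bypass, p.bypass_isPath, fun h => hp (p.support_bypass_subset_support h)⟩
  have hgood : Good G (insert w {z | z ∈ q.support}) := by
    have h0 : (G.induce {z | z ∈ q.support}).Connected := q.connected_induce_support
    constructor
    · apply conn_of_walks w (by simp)
      rintro y (rfl | hy)
      · exact ⟨SimpleGraph.Walk.nil, by simp⟩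
      · refine ⟨SimpleGraph.Walk.cons hu (q.takeUntil y hy), ?_⟩
        intro z hz
        rw [SimpleGraph.Walk.support_cons, List.mem_cons] at hz
        rcases hz with rfl | hz
        · simp
        · exact Or.inr (q.support_takeUntil_subset_support hy hz)
    · rintro x (rfl | hx)
      · have : (insert x {z | z ∈ q.support} \ {x} : Set V) = {z | z ∈ q.support} := by
          ext z
          simp only [Set.mem_sdiff, Set.mem_insert_iff, Set.mem_ofPred_eq, Set.mem_singleton_iff]
          constructor
          · rintro ⟨h | h, h'⟩
            · exact absurd h h'
            · exact h
          · intro h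
            exact ⟨Or.inr h, fun h' => hqs (h' ▸ h)⟩
        rw [this]
        exact h0
      · have hwx : w ≠ x := fun h => hqs (h ▸ hx)
        refine conn_of_walks w (by simp [hwx]) ?_
        rintro y ⟨rfl | hy, hyx⟩
        · exact ⟨SimpleGraph.Walk.nil, by simp [hwx]⟩
        · have hyx' : y ≠ x := hyx
          by_cases hx1 : x ∈ (q.takeUntil y hy).support
          · have hx2 : x ∉ (q.dropUntil y hy).support := by
              intro hx2
              have hq' := hq
              rw [← q.take_spec hy] at hq'
              exact SimpleGraph.Walk.IsPath.ne_of_mem_support_of_append hq' hyx'.symm hx1 hx2 rfl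
            refine ⟨SimpleGraph.Walk.cons hv (q.dropUntil y hy).reverse, ?_⟩
            intro z hz
            rw [SimpleGraph.Walk.support_cons, List.mem_cons] at hz
            rcases hz with rfl | hz
            · simp [hwx]
            · rw [SimpleGraph.Walk.support_reverse, List.mem_reverse] at hz
              exact ⟨Or.inr (q.support_dropUntil_subset_support hy hz), fun h => hx2 (h ▸ hz)⟩
          · refine ⟨SimpleGraph.Walk.cons hu (q.takeUntil y hy), ?_⟩
            intro z hz
            rw [SimpleGraph.Walk.support_cons, List.mem_cons] at hz
            rcases hz with rfl | hz
            · simp [hwx]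
            · exact ⟨Or.inr (q.support_takeUntil_subset_support hy hz), fun h => hx1 (h ▸ hz)⟩
  exact good_clique hG hgood (Or.inr q.start_mem_support) (Or.inr q.end_mem_support) huv

/-- a vertex no closer than `u` can be avoided going from `u` to the root -/
theorem exists_avoid {G : SimpleGraph V} (hG : G.Connected) (c u s : V) (hus : u ≠ s)
    (h : G.dist u c ≤ G.dist s c) : ∃ p : G.Walk u c, s ∉ p.support := by
  classical
  obtain ⟨p, hp⟩ := hG.exists_walk_length_eq_dist u c
  refine ⟨p, fun hs => ?_⟩
  have h1 := congrArg SimpleGraph.Walk.length (p.take_spec hs)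
  rw [SimpleGraph.Walk.length_append] at h1
  have h2 := G.dist_le (p.dropUntil s hs)
  have h3 : (p.takeUntil s hs).length = 0 := by omega
  exact hus (SimpleGraph.Walk.eq_of_length_eq_zero h3)

theorem exists_avoid2 {G : SimpleGraph V} (hG : G.Connected) (c u v s : V) (hus : u ≠ s)
    (h : G.dist u c ≤ G.dist s c) (hvs : v ≠ s) (h' : G.dist v c ≤ G.dist s c) :
    ∃ p : G.Walk u v, s ∉ p.support := by
  obtain ⟨p, hp⟩ := exists_avoid hG c u s hus h
  obtain ⟨q, hq⟩ := exists_avoid hG c v s hvs h'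
  refine ⟨p.append q.reverse, ?_⟩
  rw [SimpleGraph.Walk.mem_support_append_iff, SimpleGraph.Walk.support_reverse, List.mem_reverse]
  tauto

theorem lower_clique [Finite V] {G : SimpleGraph V} (hG : IsBlockGraph G) (c s u v : V)
    (hu : G.Adj s u) (hv : G.Adj s v) (huv : u ≠ v)
    (hus : G.dist u c ≤ G.dist s c) (hvs : G.dist v c ≤ G.dist s c) : G.Adj u v := by
  obtain ⟨p, hp⟩ := exists_avoid2 hG.1 c u v s hu.ne' hus hv.ne' hvs
  exact key_adj hG hu hv huv p hp

theorem parent_unique [Finite V] {G : SimpleGraph V} (hG : IsBlockGraph G) (c d u v : V)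
    (hu : G.Adj d u) (hv : G.Adj d v)
    (hus : G.dist u c < G.dist d c) (hvs : G.dist v c < G.dist d c) : u = v := by
  by_contra huv
  wlog hle : G.dist v c ≤ G.dist u c generalizing u v
  · exact this v u hv hu hvs hus (Ne.symm huv) (by omega)
  have hadj := lower_clique hG c d u v hu hv huv hus.le hvs.le
  have huc : u ≠ c := by
    rintro rfl
    have : G.dist v u = 0 := by simpa using hle
    exact huv ((hG.1.dist_eq_zero_iff).1 this).symm
  -- the parent of u
  obtain ⟨w, hw, hwd⟩ : ∃ w, G.Adj u w ∧ G.dist w c < G.dist u c := by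
    obtain ⟨p, hp⟩ := hG.1.exists_walk_length_eq_dist u c
    cases p with
    | nil => exact absurd rfl huc
    | cons h q =>
      refine ⟨_, h, ?_⟩
      have := G.dist_le q
      rw [SimpleGraph.Walk.length_cons] at hp
      omega
  obtain ⟨p, hp⟩ := exists_avoid2 hG.1 c v w u (Ne.symm huv) hle hw.ne' hwd.le
  have hdw : d ≠ w := by
    rintro rfl
    omega
  have := key_adj hG hu.symm hw hdw (SimpleGraph.Walk.cons hv p) (by
    rw [SimpleGraph.Walk.support_cons, List.mem_cons]
    rintro (h | h)
    · exact hu.ne' h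
    · exact hp h)
  have h2 := hG.1.dist_triangle (u := d) (v := w) (w := c)
  rw [SimpleGraph.dist_eq_one_iff_adj.2 this] at h2
  omega

/-- Structural conclusion from a dominating vertex. -/
theorem central_of_dom [Finite V] {G : SimpleGraph V} (hG : IsBlockGraph G) (c : V)
    (hc : ∀ v, v ≠ c → G.Adj c v) (hnc : ∃ u v, u ≠ v ∧ ¬ G.Adj u v) :
    IsCutVertex G c ∧ (∀ v, IsCutVertex G v → v = c) ∧ ∀ B : Set V, IsBlock G B → c ∈ B := by
  refine ⟨?_, ?_, ?_⟩
  · rw [cut_iff]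
    refine ⟨hG.1, fun h => ?_⟩
    obtain ⟨u, v, huv, hn⟩ := hnc
    have : Good G Set.univ := by
      refine ⟨conn_of_dom c trivial fun y _ => hc y, fun v _ => ?_⟩
      by_cases hv : v = c
      · subst hv
        rw [← Set.compl_eq_univ_sdiff]
        exact h
      · exact conn_of_dom c ⟨trivial, Ne.symm hv⟩ fun y _ => hc y
    exact hn (good_clique hG this trivial trivial huv)
  · intro v hv
    rw [cut_iff] at hv
    by_contra hvc
    exact hv.2 (conn_of_dom c (Ne.symm hvc) fun y _ => hc y)
  · intro B hB
    rw [block_iff] at hB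
    by_contra hcB
    have : Good G (insert c B) := by
      refine ⟨conn_of_dom c (by simp) fun y _ => hc y, ?_⟩
      rintro v (rfl | hv)
      · rw [Set.insert_sdiff_self_of_notMem hcB]
        exact hB.1.1
      · exact conn_of_dom c ⟨by simp, fun h => hcB (h ▸ hv)⟩ fun y _ => hc y
    exact hcB (hB.2 this (Set.subset_insert c B) (Set.mem_insert c B))

/-- A graph with a dominating vertex whose other adjacencies are transitive is a block graph. -/
theorem blockGraph_of_dom [Finite V] {G : SimpleGraph V} (c : V)
    (hc : ∀ v, v ≠ c → G.Adj c v)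
    (ht : ∀ u v w, u ≠ c → v ≠ c → w ≠ c → u ≠ w → G.Adj u v → G.Adj v w → G.Adj u w) :
    IsBlockGraph G := by
  constructor
  · have := conn_of_dom (G := G) (s := Set.univ) c trivial fun y _ => hc y
    exact (SimpleGraph.induceUnivIso G).connected_iff.1 this
  · intro B hB u hu v hv huv
    rw [block_iff] at hB
    by_cases huc : u = c
    · subst huc; exact hc v huv.symm
    by_cases hvc : v = c
    · subst hvc; exact (hc u huv).symm
    have hconn : (G.induce (B \ {c})).Connected := by
      by_cases hcB : c ∈ B
      · exact hB.1.2 c hcB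
      · rw [Set.sdiff_singleton_eq_self hcB]
        exact hB.1.1
    have key : ∀ (a b : (B \ {c} : Set V)) (p : (G.induce (B \ {c})).Walk a b),
        a = b ∨ G.Adj a b := by
      intro a b p
      induction p with
      | nil => exact Or.inl rfl
      | @cons a d b h q ih =>
        by_cases hab : a = b
        · exact Or.inl hab
        right
        have h' : G.Adj a d := h
        rcases ih with rfl | ih
        · exact h'
        · exact ht a d b a.2.2 d.2.2 b.2.2 (fun h => hab (Subtype.ext h)) h' ih
    obtain ⟨p⟩ := hconn.preconnected ⟨u, hu, huc⟩ ⟨v, hv, hvc⟩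
    rcases key _ _ p with h | h
    · exact absurd (congrArg Subtype.val h) huv
    · exact h

section spectral
variable [Fintype V]

theorem adjMat_symm (G : SimpleGraph V) (u v : V) : adjMat G u v = adjMat G v u := by
  by_cases h : G.Adj u v
  · simp [adjMat, h, h.symm]
  · have h' : ¬ G.Adj v u := fun h' => h h'.symm
    simp [adjMat, h, h']

theorem adjMat_nonneg (G : SimpleGraph V) (u v : V) : 0 ≤ adjMat G u v := by
  simp only [adjMat, Matrix.of_apply]
  split_ifs <;> norm_num

theorem adjMat_le_one (G : SimpleGraph V) (u v : V) : adjMat G u v ≤ 1 := by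
  simp only [adjMat, Matrix.of_apply]
  split_ifs <;> norm_num

theorem adjMat_of_adj {G : SimpleGraph V} {u v : V} (h : G.Adj u v) : adjMat G u v = 1 := by
  simp [adjMat, h]

theorem adjMat_of_not {G : SimpleGraph V} {u v : V} (h : ¬ G.Adj u v) : adjMat G u v = 0 := by
  simp [adjMat, h]

/-- quadratic form -/
noncomputable def qf (G : SimpleGraph V) (x : V → ℝ) : ℝ :=
  ∑ u, ∑ v, adjMat G u v * (x u * x v)

theorem qf_eq (G : SimpleGraph V) (x : V → ℝ) : x ⬝ᵥ (adjMat G).mulVec x = qf G x := by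
  simp only [dotProduct, Matrix.mulVec, qf, Finset.mul_sum]
  refine Finset.sum_congr rfl fun u _ => Finset.sum_congr rfl fun v _ => by ring

theorem finite_eig (G : SimpleGraph V) :
    {r : ℝ | ∃ x : V → ℝ, x ≠ 0 ∧ (adjMat G).mulVec x = r • x}.Finite := by
  classical
  refine (Module.End.finite_hasEigenvalue (Matrix.toLin' (adjMat G))).subset ?_
  rintro r ⟨x, hx, h⟩
  exact Module.End.hasEigenvalue_of_hasEigenvector (x := x)
    (Module.End.hasEigenvector_iff.2 ⟨Module.End.mem_eigenspace_iff.2 (by simpa using h), hx⟩)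

theorem isHerm (G : SimpleGraph V) : (adjMat G).IsHermitian := by
  ext u v
  simp [adjMat_symm G u v]

open Classical in
theorem psd (G : SimpleGraph V) :
    (specRad G • (1 : Matrix V V ℝ) - adjMat G).PosSemidef := by
  have hH : (specRad G • (1 : Matrix V V ℝ) - adjMat G).IsHermitian := by
    apply Matrix.IsHermitian.sub _ (isHerm G)
    ext u v
    simp [Matrix.one_apply, eq_comm]
  rw [hH.posSemidef_iff_eigenvalues_nonneg]
  intro i
  have h := hH.mulVec_eigenvectorBasis i
  set y : V → ℝ := ⇑(hH.eigenvectorBasis i) with hy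
  have hy0 : y ≠ 0 := by
    intro h0
    have h1 := hH.eigenvectorBasis.orthonormal.ne_zero i
    apply h1
    ext j
    exact congrFun h0 j
  rw [Matrix.sub_mulVec, Matrix.smul_mulVec, Matrix.one_mulVec] at h
  have h2 : (adjMat G).mulVec y = (specRad G - hH.eigenvalues i) • y := by
    rw [sub_smul, ← h]; abel
  have h3 : specRad G - hH.eigenvalues i ≤ specRad G :=
    le_csSup (finite_eig G).bddAbove ⟨y, hy0, h2⟩
  simpa using h3

theorem psd_dot (G : SimpleGraph V) (x : V → ℝ) [DecidableEq V] :
    star x ⬝ᵥ (specRad G • (1 : Matrix V V ℝ) - adjMat G).mulVec x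
      = specRad G * (x ⬝ᵥ x) - qf G x := by
  rw [Matrix.sub_mulVec, Matrix.smul_mulVec, Matrix.one_mulVec, dotProduct_sub, dotProduct_smul,
    star_trivial, qf_eq, smul_eq_mul]

theorem qf_le (G : SimpleGraph V) (x : V → ℝ) : qf G x ≤ specRad G * (x ⬝ᵥ x) := by
  classical
  have h := (psd G).dotProduct_mulVec_nonneg x
  have h2 := psd_dot G x
  linarith

theorem eig_of_qf (G : SimpleGraph V) (x : V → ℝ) (h : specRad G * (x ⬝ᵥ x) ≤ qf G x) :
    (adjMat G).mulVec x = specRad G • x := by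
  classical
  have h1 := qf_le G x
  have h2 := psd_dot G x
  have h3 := ((psd G).dotProduct_mulVec_zero_iff x).1 (by rw [h2]; linarith)
  rw [Matrix.sub_mulVec, Matrix.smul_mulVec, Matrix.one_mulVec] at h3
  exact (sub_eq_zero.1 h3).symm

theorem exists_top [Nonempty V] (G : SimpleGraph V) :
    ∃ x : V → ℝ, x ≠ 0 ∧ (adjMat G).mulVec x = specRad G • x := by
  classical
  have hne : {r : ℝ | ∃ x : V → ℝ, x ≠ 0 ∧ (adjMat G).mulVec x = r • x}.Nonempty := by
    obtain ⟨i⟩ := ‹Nonempty V›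
    refine ⟨(isHerm G).eigenvalues i, ⇑((isHerm G).eigenvectorBasis i), ?_,
      (isHerm G).mulVec_eigenvectorBasis i⟩
    intro h0
    apply (isHerm G).eigenvectorBasis.orthonormal.ne_zero i
    ext j
    exact congrFun h0 j
  exact hne.csSup_mem (finite_eig G)

theorem exists_perron (G : SimpleGraph V) (hG : G.Connected) : ∃ x, IsPerron G x := by
  have := hG.nonempty
  obtain ⟨y, hy0, hy⟩ := exists_top G
  have h1 : qf G y = specRad G * (y ⬝ᵥ y) := by
    rw [← qf_eq, hy, dotProduct_smul, smul_eq_mul]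
  have h2 : qf G y ≤ qf G (fun v => |y v|) := by
    refine Finset.sum_le_sum fun u _ => Finset.sum_le_sum fun v _ => ?_
    refine mul_le_mul_of_nonneg_left ?_ (adjMat_nonneg G u v)
    rw [← abs_mul]
    exact le_abs_self _
  have h3 : (fun v => |y v|) ⬝ᵥ (fun v => |y v|) = y ⬝ᵥ y := by
    simp [dotProduct]
  have h4 := eig_of_qf G (fun v => |y v|) (by rw [h3]; linarith)
  refine ⟨_, ?_, h4⟩
  have step : ∀ u v, G.Adj u v → y u = 0 → y v = 0 := by
    intro u v huv hu
    have h5 := congrFun h4 u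
    simp only [Matrix.mulVec, dotProduct, Pi.smul_apply, hu, abs_zero, smul_zero] at h5
    rw [Finset.sum_eq_zero_iff_of_nonneg
      (fun i _ => mul_nonneg (adjMat_nonneg G u i) (abs_nonneg _))] at h5
    have := h5 v (Finset.mem_univ _)
    rw [adjMat_of_adj huv] at this
    simpa using this
  intro v
  rw [abs_pos]
  intro hv
  apply hy0
  funext w
  obtain ⟨p⟩ := hG.preconnected v w
  induction p with
  | nil => exact hv
  | cons h q ih => exact ih (step _ _ h hv)

/-- The comparison principle. -/
theorem dom_of_compare (G H : SimpleGraph V) (x : V → ℝ) (hx : IsPerron G x)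
    (hρ : specRad H ≤ specRad G) (hq : qf G x ≤ qf H x) (c : V)
    (hc : ∀ v, v ≠ c → H.Adj c v) : ∀ v, v ≠ c → G.Adj c v := by
  have h1 : qf G x = specRad G * (x ⬝ᵥ x) := by
    rw [← qf_eq, hx.2, dotProduct_smul, smul_eq_mul]
  have hpos : 0 < x ⬝ᵥ x :=
    Finset.sum_pos (fun i _ => mul_pos (hx.1 i) (hx.1 i)) ⟨c, Finset.mem_univ _⟩
  have h2 := qf_le H x
  have h3 : specRad H = specRad G := by
    apply le_antisymm hρ
    exact le_of_mul_le_mul_right (by linarith) hpos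
  have h4 := eig_of_qf H x (by rw [h3]; linarith)
  have h5 : ∑ v, adjMat H c v * x v = ∑ v, adjMat G c v * x v := by
    have a := congrFun h4 c
    have b := congrFun hx.2 c
    rw [h3, Pi.smul_apply] at a
    rw [Pi.smul_apply] at b
    exact a.trans b.symm
  intro v hv
  by_contra hn
  have : ∑ v, adjMat G c v * x v < ∑ v, adjMat H c v * x v := by
    apply Finset.sum_lt_sum
    · intro i _
      refine mul_le_mul_of_nonneg_right ?_ (hx.1 i).le
      by_cases hi : i = c
      · subst hi
        rw [adjMat_of_not (G.irrefl), adjMat_of_not (H.irrefl)]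
      · rw [adjMat_of_adj (hc i hi)]
        exact adjMat_le_one G c i
    · refine ⟨v, Finset.mem_univ _, ?_⟩
      rw [adjMat_of_not hn, adjMat_of_adj (hc v hv)]
      simpa using hx.1 v
  linarith

end spectral

section construction

theorem dissoc_iff [Finite V] (G : SimpleGraph V) (D : Set V) :
    IsDissoc G D ↔ ∀ v ∈ D, ∀ a ∈ D, ∀ b ∈ D, G.Adj v a → G.Adj v b → a = b := by
  unfold IsDissoc
  refine forall₂_congr fun v _ => ?_
  rw [Set.ncard_le_one (Set.toFinite _)]
  constructor
  · intro h a ha b hb h1 h2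
    exact h a ⟨ha, h1⟩ b ⟨hb, h2⟩
  · rintro h a ⟨ha, h1⟩ b ⟨hb, h2⟩
    exact h a ha b hb h1 h2

theorem clique_le_two [Finite V] {G : SimpleGraph V} {D T : Set V} (hD : IsDissoc G D)
    (hT : T ⊆ D) (hc : T.Pairwise G.Adj) : T.ncard ≤ 2 := by
  rcases T.eq_empty_or_nonempty with rfl | ⟨v, hv⟩
  · simp
  · have h1 := hD v (hT hv)
    have h2 : T \ {v} ⊆ D ∩ {u | G.Adj v u} := fun u hu =>
      ⟨hT hu.1, hc hv hu.1 (Ne.symm hu.2)⟩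
    have h3 := Set.ncard_le_ncard h2 (Set.toFinite _)
    have h4 := Set.ncard_sdiff_singleton_add_one hv (Set.toFinite T)
    omega

theorem dissoc_bdd [Fintype V] (G : SimpleGraph V) :
    BddAbove {n : ℕ | ∃ D : Set V, IsDissoc G D ∧ D.ncard = n} := by
  refine ⟨Nat.card V, ?_⟩
  rintro n ⟨D, _, rfl⟩
  exact Set.ncard_le_card D

theorem dissoc_le [Fintype V] {G : SimpleGraph V} {D : Set V} (h : IsDissoc G D) :
    D.ncard ≤ dissocNum G := le_csSup (dissoc_bdd G) ⟨D, h, rfl⟩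

theorem exists_maxDissoc [Fintype V] (G : SimpleGraph V) : ∃ D, IsMaxDissoc G D := by
  have : dissocNum G ∈ {n : ℕ | ∃ D : Set V, IsDissoc G D ∧ D.ncard = n} :=
    Nat.sSup_mem ⟨0, ∅, by simp [IsDissoc], by simp⟩ (dissoc_bdd G)
  exact this

/-- The comparison graph. -/
def HG (G : SimpleGraph V) (D : Set V) (c p q : V) : SimpleGraph V where
  Adj u v := u ≠ v ∧ (u = c ∨ v = c ∨ ((u ∉ D ∨ u = p ∨ u = q) ∧ (v ∉ D ∨ v = p ∨ v = q)) ∨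
    (¬ (u ∉ D ∨ u = p ∨ u = q) ∧ ¬ (v ∉ D ∨ v = p ∨ v = q) ∧
      (G.Adj u v ∨ (G.Adj p u ∧ G.Adj q v) ∨ (G.Adj q u ∧ G.Adj p v))))
  symm := ⟨by
    rintro u v ⟨h0, h | h | ⟨h1, h2⟩ | ⟨h1, h2, h3⟩⟩
    · exact ⟨h0.symm, Or.inr (Or.inl h)⟩
    · exact ⟨h0.symm, Or.inl h⟩
    · exact ⟨h0.symm, Or.inr (Or.inr (Or.inl ⟨h2, h1⟩))⟩
    · refine ⟨h0.symm, Or.inr (Or.inr (Or.inr ⟨h2, h1, ?_⟩))⟩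
      rcases h3 with h | h | h
      · exact Or.inl h.symm
      · exact Or.inr (Or.inr h.symm)
      · exact Or.inr (Or.inl h.symm)⟩
  loopless := ⟨fun u h => h.1 rfl⟩

theorem HG_dom (G : SimpleGraph V) (D : Set V) (c p q : V) (v : V) (hv : v ≠ c) :
    (HG G D c p q).Adj c v := ⟨hv.symm, Or.inl rfl⟩

theorem match_unique [Finite V] {G : SimpleGraph V} {D : Set V} (hD : IsDissoc G D)
    {p q : V} (hp : p ∈ D) (hq : q ∈ D) (hpq : p ≠ q) {u v w : V}
    (hu : u ∈ D) (hv : v ∈ D) (hw : w ∈ D) (hup : u ≠ p) (huq : u ≠ q) (hvp : v ≠ p) (hvq : v ≠ q)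
    (hwp : w ≠ p) (hwq : w ≠ q)
    (h1 : G.Adj u v ∨ (G.Adj p u ∧ G.Adj q v) ∨ (G.Adj q u ∧ G.Adj p v))
    (h2 : G.Adj v w ∨ (G.Adj p v ∧ G.Adj q w) ∨ (G.Adj q v ∧ G.Adj p w)) : u = w := by
  have h := (dissoc_iff G D).1 hD
  rcases h1 with h1 | ⟨h1, h1'⟩ | ⟨h1, h1'⟩ <;> rcases h2 with h2 | ⟨h2, h2'⟩ | ⟨h2, h2'⟩
  · exact h v hv u hu w hw h1.symm h2
  · exact absurd (h v hv u hu p hp h1.symm h2.symm) hup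
  · exact absurd (h v hv u hu q hq h1.symm h2.symm) huq
  · exact absurd (h v hv w hw q hq h2 h1'.symm) hwq
  · exact absurd (h v hv p hp q hq h2.symm h1'.symm) hpq
  · exact h p hp u hu w hw h1 h2'
  · exact absurd (h v hv w hw p hp h2 h1'.symm) hwp
  · exact h q hq u hu w hw h1 h2'
  · exact absurd (h v hv p hp q hq h1'.symm h2.symm) hpq

theorem HG_block [Finite V] {G : SimpleGraph V} {D : Set V} (hD : IsDissoc G D)
    {c p q : V} (hp : p ∈ D) (hq : q ∈ D) (hpq : p ≠ q) : IsBlockGraph (HG G D c p q) := by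
  apply blockGraph_of_dom c (HG_dom G D c p q)
  rintro u v w hu hv hw huw ⟨-, h1⟩ ⟨-, h2⟩
  refine ⟨huw, ?_⟩
  simp only [hu, hv, hw, false_or] at h1 h2 ⊢
  rcases h1 with h1 | h1 <;> rcases h2 with h2 | h2
  · exact Or.inl ⟨h1.1, h2.2⟩
  · exact absurd h1.2 h2.1
  · exact absurd h2.1 h1.2.1
  · exfalso
    apply huw
    obtain ⟨a1, a2, a3⟩ := h1
    obtain ⟨-, b2, b3⟩ := h2
    push Not at a1 a2 b2
    exact match_unique hD hp hq hpq a1.1 a2.1 b2.1 a1.2.1 a1.2.2 a2.2.1 a2.2.2 b2.2.1 b2.2.2 a3 b3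

theorem HG_dissocNum [Fintype V] {G : SimpleGraph V} {D : Set V} (hD : IsDissoc G D)
    {c p q : V} (hp : p ∈ D) (hq : q ∈ D) (hpq : p ≠ q) (hc : c ∉ D) :
    dissocNum (HG G D c p q) = D.ncard := by
  apply le_antisymm
  · obtain ⟨E, hE, hcard⟩ := exists_maxDissoc (HG G D c p q)
    rw [← hcard]
    have h2 : ({p, q} : Set V).ncard = 2 := Set.ncard_pair hpq
    have hsub : ({p, q} : Set V) ⊆ D := by
      rintro z (rfl | rfl) <;> assumption
    have h2D := Set.ncard_le_ncard hsub (Set.toFinite _)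
    have hdiff := Set.ncard_sdiff_add_ncard_of_subset hsub (Set.toFinite _)
    by_cases hcE : c ∈ E
    · have h1 := hE c hcE
      have h3 : E \ {c} ⊆ E ∩ {u | (HG G D c p q).Adj c u} := fun u hu =>
        ⟨hu.1, HG_dom G D c p q u hu.2⟩
      have h4 := Set.ncard_le_ncard h3 (Set.toFinite _)
      have h5 := Set.ncard_sdiff_singleton_add_one hcE (Set.toFinite _)
      omega
    · have hT : (E \ (D \ {p, q})).ncard ≤ 2 := by
        apply clique_le_two hE Set.sdiff_subset
        rintro u ⟨hu, hu'⟩ v ⟨hv, hv'⟩ huv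
        refine ⟨huv, Or.inr (Or.inr (Or.inl ⟨?_, ?_⟩))⟩
        · simp only [Set.mem_sdiff, Set.mem_insert_iff, Set.mem_singleton_iff] at hu'
          tauto
        · simp only [Set.mem_sdiff, Set.mem_insert_iff, Set.mem_singleton_iff] at hv'
          tauto
      have h6 := Set.ncard_le_ncard_sdiff_add_ncard E (D \ {p, q}) (Set.toFinite _)
      omega
  · apply dissoc_le
    rw [dissoc_iff]
    have aux : ∀ v ∈ D, ∀ a ∈ D, (HG G D c p q).Adj v a → v ≠ a ∧
        (((v = p ∨ v = q) ∧ (a = p ∨ a = q)) ∨ ((v ≠ p ∧ v ≠ q) ∧ (a ≠ p ∧ a ≠ q) ∧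
        (G.Adj v a ∨ (G.Adj p v ∧ G.Adj q a) ∨ (G.Adj q v ∧ G.Adj p a)))) := by
      rintro v hv a ha ⟨h1, h2⟩
      refine ⟨h1, ?_⟩
      have hvc : v ≠ c := fun h => hc (h ▸ hv)
      have hac : a ≠ c := fun h => hc (h ▸ ha)
      simp only [hvc, hac, hv, ha, not_true_eq_false, false_or, not_or] at h2
      exact h2
    intro v hv a ha b hb h1 h2
    obtain ⟨n1, h1⟩ := aux a ha v hv h1.symm
    obtain ⟨n2, h2⟩ := aux v hv b hb h2
    rcases h1 with h1 | ⟨a1, a2, a3⟩ <;> rcases h2 with h2 | ⟨b1, b2, b3⟩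
    · grind
    · grind
    · grind
    · exact match_unique hD hp hq hpq ha hv hb a1.1 a1.2 a2.1 a2.2 b2.1 b2.2 a3 b3

end construction

section inequality
variable [Fintype V]

theorem sum_le_single (T : Finset V) (P : V → Prop) [DecidablePred P] (x : V → ℝ) (M : ℝ)
    (hM : 0 ≤ M) (h1 : ∀ r ∈ T, P r → x r ≤ M)
    (h2 : ∀ r ∈ T, ∀ r' ∈ T, P r → P r' → r = r') :
    ∑ r ∈ T, (if P r then (1 : ℝ) else 0) * x r ≤ M := by
  by_cases h : ∃ r ∈ T, P r
  · obtain ⟨r, hr, hPr⟩ := h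
    rw [Finset.sum_eq_single_of_mem r hr]
    · simpa [hPr] using h1 r hr hPr
    · intro b hb hbr
      rw [if_neg fun hPb => hbr (h2 b hb r hr hPb hPr), zero_mul]
  · push Not at h
    rw [Finset.sum_eq_zero fun r hr => by rw [if_neg (h r hr), zero_mul]]
    exact hM

theorem sum_le_pair (T : Finset V) (x : V → ℝ) (p q : V) (hx : ∀ v, 0 < x v) (hT : T.card ≤ 2)
    (hp : ∀ d ∈ T, x d ≤ x p) (hq : ∀ d ∈ T, d ≠ p → x d ≤ x q) (hqp : x q ≤ x p) :
    ∑ d ∈ T, x d ≤ x p + x q := by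
  classical
  have h0 := hx p
  have h0' := hx q
  interval_cases h : T.card
  · rw [Finset.card_eq_zero.1 h]
    simp
    linarith
  · obtain ⟨a, rfl⟩ := Finset.card_eq_one.1 h
    simp
    have := hp a (by simp)
    linarith
  · obtain ⟨a, b, hab, rfl⟩ := Finset.card_eq_two.1 h
    rw [Finset.sum_pair hab]
    by_cases hap : a = p
    · subst hap
      have := hq b (by simp) hab.symm
      linarith
    · have h1 := hq a (by simp) hap
      have h2 := hp b (by simp)
      linarith

theorem split_qf [DecidableEq V] (D : Finset V) (f : V → V → ℝ) (hf : ∀ u v, f u v = f v u) :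
    ∑ u, ∑ v, f u v = ∑ u ∈ Dᶜ, ∑ v ∈ Dᶜ, f u v + 2 * ∑ u ∈ Dᶜ, ∑ v ∈ D, f u v
      + ∑ u ∈ D, ∑ v ∈ D, f u v := by
  have h : ∀ g : V → ℝ, ∑ u, g u = ∑ u ∈ Dᶜ, g u + ∑ u ∈ D, g u := fun g =>
    (Finset.sum_compl_add_sum D g).symm
  rw [h, Finset.sum_congr rfl fun u _ => h (f u), Finset.sum_congr (s₁ := D) rfl fun u _ => h (f u),
    Finset.sum_add_distrib, Finset.sum_add_distrib]
  have : ∑ u ∈ D, ∑ v ∈ Dᶜ, f u v = ∑ u ∈ Dᶜ, ∑ v ∈ D, f u v := by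
    rw [Finset.sum_comm]
    exact Finset.sum_congr rfl fun u _ => Finset.sum_congr rfl fun v _ => hf v u
  rw [this]
  ring

theorem split_D [DecidableEq V] (R : Finset V) (p q : V) (hp : p ∉ R) (hq : q ∉ R) (hpq : p ≠ q)
    (f : V → V → ℝ) (hf : ∀ u v, f u v = f v u) (h0 : ∀ u, f u u = 0) :
    ∑ u ∈ insert p (insert q R), ∑ v ∈ insert p (insert q R), f u v
      = ∑ u ∈ R, ∑ v ∈ R, f u v + 2 * f p q + 2 * ∑ r ∈ R, f p r + 2 * ∑ r ∈ R, f q r := by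
  have hp' : p ∉ insert q R := by simp [hpq, hp]
  have h : ∀ g : V → ℝ, ∑ u ∈ insert p (insert q R), g u = g p + (g q + ∑ u ∈ R, g u) := fun g => by
    rw [Finset.sum_insert hp', Finset.sum_insert hq]
  rw [h, h, h, Finset.sum_congr rfl fun u _ => h (f u), Finset.sum_add_distrib,
    Finset.sum_add_distrib, h0, h0, hf q p, Finset.sum_congr rfl fun u _ => hf u p,
    Finset.sum_congr rfl fun u _ => hf u q]
  ring

/-- cross edges -/
theorem cross_le [DecidableEq V] {G : SimpleGraph V} (hG : IsBlockGraph G) (D : Finset V)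
    (hD : IsDissoc G (D : Set V)) (x : V → ℝ) (hx : ∀ v, 0 < x v) (c p q : V) (hc : c ∉ D)
    (hcmax : ∀ s, s ∉ D → x s ≤ x c)
    (hp : ∀ d ∈ D, x d ≤ x p) (hq : ∀ d ∈ D, d ≠ p → x d ≤ x q) (hqp : x q ≤ x p) :
    ∑ s ∈ Dᶜ, ∑ d ∈ D, adjMat G s d * (x s * x d)
      ≤ ∑ d ∈ D, x c * x d + ∑ s ∈ Dᶜ.erase c, x s * (x p + x q) := by
  classical
  let A : V → V → Prop := fun s d => G.Adj d s ∧ G.dist s c < G.dist d c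
  let B : V → V → Prop := fun s d => G.Adj s d ∧ G.dist d c ≤ G.dist s c
  have hsplit : ∀ s d, adjMat G s d * (x s * x d) =
      x d * ((if A s d then (1 : ℝ) else 0) * x s) + x s * ((if B s d then (1 : ℝ) else 0) * x d) := by
    intro s d
    by_cases h : G.Adj s d
    · rw [adjMat_of_adj h]
      by_cases h' : G.dist s c < G.dist d c
      · have hA : A s d := ⟨h.symm, h'⟩
        have hB : ¬ B s d := fun hb => absurd hb.2 (by omega)
        rw [if_pos hA, if_neg hB]; ring
      · have hA : ¬ A s d := fun ha => h' ha.2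
        have hB : B s d := ⟨h, by omega⟩
        rw [if_neg hA, if_pos hB]; ring
    · have hA : ¬ A s d := fun ha => h ha.1.symm
      have hB : ¬ B s d := fun hb => h hb.1
      rw [adjMat_of_not h, if_neg hA, if_neg hB]; ring
  simp only [hsplit, Finset.sum_add_distrib]
  apply add_le_add
  · rw [Finset.sum_comm]
    refine Finset.sum_le_sum fun d hd => ?_
    rw [← Finset.mul_sum, mul_comm (x c)]
    refine mul_le_mul_of_nonneg_left ?_ (hx d).le
    apply sum_le_single _ _ _ _ (hx c).le
    · intro r hr _
      exact hcmax r (by simpa using hr)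
    · intro r _ r' _ h1 h2
      exact parent_unique hG c d r r' h1.1 h2.1 h1.2 h2.2
  · have hcD : c ∈ Dᶜ := by simpa using hc
    rw [← Finset.add_sum_erase _ _ hcD]
    have hz : ∑ d ∈ D, x c * ((if B c d then (1 : ℝ) else 0) * x d) = 0 := by
      apply Finset.sum_eq_zero
      intro d hd
      have : ¬ B c d := by
        rintro ⟨h1, h2⟩
        rw [SimpleGraph.dist_self, Nat.le_zero] at h2
        exact h1.ne' ((hG.1.dist_eq_zero_iff).1 h2)
      rw [if_neg this]; ring
    rw [hz, zero_add]
    refine Finset.sum_le_sum fun s hs => ?_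
    rw [← Finset.mul_sum]
    refine mul_le_mul_of_nonneg_left ?_ (hx s).le
    have : ∑ d ∈ D, (if B s d then (1 : ℝ) else 0) * x d = ∑ d ∈ D.filter (B s), x d := by
      rw [Finset.sum_filter]
      refine Finset.sum_congr rfl fun d _ => ?_
      split_ifs <;> simp
    rw [this]
    apply sum_le_pair _ x p q hx
    · rw [← Set.ncard_coe_finset]
      apply clique_le_two hD
      · intro d hd
        exact (Finset.mem_filter.1 hd).1
      · intro u hu v hv huv
        have hu' := (Finset.mem_filter.1 hu).2
        have hv' := (Finset.mem_filter.1 hv).2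
        exact lower_clique hG c s u v hu'.1 hv'.1 huv hu'.2 hv'.2
    · intro d hd
      exact hp d (Finset.mem_filter.1 hd).1
    · intro d hd
      exact hq d (Finset.mem_filter.1 hd).1
    · exact hqp

theorem qf_HG_ge [DecidableEq V] {G : SimpleGraph V} (hG : IsBlockGraph G) (D : Finset V)
    (hD : IsDissoc G (D : Set V)) (x : V → ℝ) (hx : ∀ v, 0 < x v) (c p q : V) (hc : c ∉ D)
    (hpD : p ∈ D) (hqD : q ∈ D) (hpq : p ≠ q)
    (hcmax : ∀ s, s ∉ D → x s ≤ x c)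
    (hp : ∀ d ∈ D, x d ≤ x p) (hq : ∀ d ∈ D, d ≠ p → x d ≤ x q) :
    qf G x ≤ qf (HG G D c p q) x := by
  classical
  have hqp : x q ≤ x p := hp q hqD
  set H := HG G D c p q with hH
  have hd := (dissoc_iff G D).1 hD
  have hnn : ∀ (K : SimpleGraph V) u v, 0 ≤ adjMat K u v * (x u * x v) := fun K u v =>
    mul_nonneg (adjMat_nonneg K u v) (mul_pos (hx u) (hx v)).le
  have hsymm : ∀ (K : SimpleGraph V) u v,
      adjMat K u v * (x u * x v) = adjMat K v u * (x v * x u) := fun K u v => by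
    rw [adjMat_symm, mul_comm (x u)]
  have hdiag : ∀ (K : SimpleGraph V) u, adjMat K u u * (x u * x u) = 0 := fun K u => by
    rw [adjMat_of_not K.irrefl, zero_mul]
  unfold qf
  rw [split_qf D _ (hsymm G), split_qf D _ (hsymm H)]
  have hS : ∑ u ∈ Dᶜ, ∑ v ∈ Dᶜ, adjMat G u v * (x u * x v)
      ≤ ∑ u ∈ Dᶜ, ∑ v ∈ Dᶜ, adjMat H u v * (x u * x v) := by
    refine Finset.sum_le_sum fun u hu => Finset.sum_le_sum fun v hv => ?_
    by_cases huv : u = v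
    · subst huv
      rw [hdiag, hdiag]
    · refine mul_le_mul_of_nonneg_right ?_ (mul_pos (hx u) (hx v)).le
      have : H.Adj u v := ⟨huv, Or.inr (Or.inr (Or.inl
        ⟨Or.inl (by simpa using hu), Or.inl (by simpa using hv)⟩))⟩
      rw [adjMat_of_adj this]
      exact adjMat_le_one G u v
  have hX : ∑ u ∈ Dᶜ, ∑ v ∈ D, adjMat G u v * (x u * x v)
      ≤ ∑ u ∈ Dᶜ, ∑ v ∈ D, adjMat H u v * (x u * x v) := by
    refine (cross_le hG D hD x hx c p q hc hcmax hp hq hqp).trans ?_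
    have hcD : c ∈ Dᶜ := by simpa using hc
    rw [← Finset.add_sum_erase _ _ hcD]
    apply add_le_add
    · refine Finset.sum_le_sum fun d hd => ?_
      have : H.Adj c d := HG_dom G D c p q d fun h => hc (h ▸ hd)
      rw [adjMat_of_adj this, one_mul]
    · refine Finset.sum_le_sum fun s hs => ?_
      have hsD : s ∉ D := by
        have := Finset.mem_of_mem_erase hs
        simpa using this
      have hsub : ({p, q} : Finset V) ⊆ D := by
        intro z hz
        simp at hz
        rcases hz with rfl | rfl <;> assumption
      refine le_trans ?_ (Finset.sum_le_sum_of_subset_of_nonneg hsub fun i _ _ => hnn H s i)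
      rw [Finset.sum_pair hpq]
      have h1 : H.Adj s p := ⟨fun h => hsD (h ▸ hpD), Or.inr (Or.inr (Or.inl
        ⟨Or.inl hsD, Or.inr (Or.inl rfl)⟩))⟩
      have h2 : H.Adj s q := ⟨fun h => hsD (h ▸ hqD), Or.inr (Or.inr (Or.inl
        ⟨Or.inl hsD, Or.inr (Or.inr rfl)⟩))⟩
      rw [adjMat_of_adj h1, adjMat_of_adj h2]
      apply le_of_eq
      ring
  have hDD : ∑ u ∈ D, ∑ v ∈ D, adjMat G u v * (x u * x v)
      ≤ ∑ u ∈ D, ∑ v ∈ D, adjMat H u v * (x u * x v) := by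
    obtain ⟨R, hR⟩ : ∃ R, R = (D.erase p).erase q := ⟨_, rfl⟩
    have hmem : ∀ r, r ∈ R ↔ r ≠ q ∧ r ≠ p ∧ r ∈ D := by
      intro r; rw [hR, Finset.mem_erase, Finset.mem_erase]
    have hDeq : insert p (insert q R) = D := by
      rw [hR, Finset.insert_erase (Finset.mem_erase.2 ⟨hpq.symm, hqD⟩), Finset.insert_erase hpD]
    have hpR : p ∉ R := fun h => ((hmem p).1 h).2.1 rfl
    have hqR : q ∉ R := fun h => ((hmem q).1 h).1 rfl
    have eG := split_D R p q hpR hqR hpq _ (hsymm G) (hdiag G)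
    have eH := split_D R p q hpR hqR hpq _ (hsymm H) (hdiag H)
    rw [hDeq] at eG eH
    rw [eG, eH]
    have hHpq : H.Adj p q := ⟨hpq, Or.inr (Or.inr (Or.inl
      ⟨Or.inr (Or.inl rfl), Or.inr (Or.inr rfl)⟩))⟩
    have n1 : 0 ≤ ∑ r ∈ R, adjMat H p r * (x p * x r) := Finset.sum_nonneg fun r _ => hnn H p r
    have n2 : 0 ≤ ∑ r ∈ R, adjMat H q r * (x q * x r) := Finset.sum_nonneg fun r _ => hnn H q r
    obtain ⟨P, hP⟩ : ∃ P, P = ∑ r ∈ R, adjMat G p r * x r := ⟨_, rfl⟩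
    obtain ⟨Q, hQ⟩ : ∃ Q, Q = ∑ r ∈ R, adjMat G q r * x r := ⟨_, rfl⟩
    have e1 : ∑ r ∈ R, adjMat G p r * (x p * x r) = x p * P := by
      rw [hP, Finset.mul_sum]
      exact Finset.sum_congr rfl fun r _ => by ring
    have e2 : ∑ r ∈ R, adjMat G q r * (x q * x r) = x q * Q := by
      rw [hQ, Finset.mul_sum]
      exact Finset.sum_congr rfl fun r _ => by ring
    have hP1 : P ≤ x q := by
      rw [hP]
      refine sum_le_single R (fun r => G.Adj p r) x (x q) (hx q).le ?_ ?_
      · intro r hr _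
        exact hq r ((hmem r).1 hr).2.2 ((hmem r).1 hr).2.1
      · intro r hr r' hr' h1 h2
        exact hd p hpD r ((hmem r).1 hr).2.2 r' ((hmem r').1 hr').2.2 h1 h2
    have hQ1 : Q ≤ x p := by
      rw [hQ]
      refine sum_le_single R (fun r => G.Adj q r) x (x p) (hx p).le ?_ ?_
      · intro r hr _
        exact hp r ((hmem r).1 hr).2.2
      · intro r hr r' hr' h1 h2
        exact hd q hqD r ((hmem r).1 hr).2.2 r' ((hmem r').1 hr').2.2 h1 h2
    have hRR : ∑ u ∈ R, ∑ v ∈ R, adjMat G u v * (x u * x v) + 2 * (P * Q)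
        ≤ ∑ u ∈ R, ∑ v ∈ R, adjMat H u v * (x u * x v) := by
      have hPQ : P * Q = ∑ u ∈ R, ∑ v ∈ R, (adjMat G p u * x u) * (adjMat G q v * x v) := by
        rw [hP, hQ, Finset.sum_mul_sum]
      have hQP : P * Q = ∑ u ∈ R, ∑ v ∈ R, (adjMat G q u * x u) * (adjMat G p v * x v) := by
        rw [mul_comm, hP, hQ, Finset.sum_mul_sum]
      have : 2 * (P * Q) = P * Q + P * Q := by ring
      rw [this]
      nth_rewrite 1 [hPQ]
      rw [hQP, ← Finset.sum_add_distrib, ← Finset.sum_add_distrib]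
      refine Finset.sum_le_sum fun u hu => ?_
      rw [← Finset.sum_add_distrib, ← Finset.sum_add_distrib]
      refine Finset.sum_le_sum fun v hv => ?_
      obtain ⟨huq, hup, huD⟩ := (hmem u).1 hu
      obtain ⟨hvq, hvp, hvD⟩ := (hmem v).1 hv
      have hle : adjMat G u v + adjMat G p u * adjMat G q v + adjMat G q u * adjMat G p v
          ≤ adjMat H u v := by
        have hHadj : u ≠ v → (G.Adj u v ∨ (G.Adj p u ∧ G.Adj q v) ∨ (G.Adj q u ∧ G.Adj p v)) →
            H.Adj u v := by
          intro h1 h2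
          refine ⟨h1, Or.inr (Or.inr (Or.inr ⟨?_, ?_, h2⟩))⟩
          · simp [huq, hup, huD]
          · simp [hvq, hvp, hvD]
        have hpqu : ∀ z ∈ D, G.Adj p z → G.Adj q z → False := fun z hz h1 h2 =>
          hpq (hd z hz p hpD q hqD h1.symm h2.symm)
        have hzz : ∀ z, adjMat G p z * adjMat G q z ≠ 0 → G.Adj p z ∧ G.Adj q z := by
          intro z hz
          constructor
          · by_contra h; exact hz (by rw [adjMat_of_not h, zero_mul])
          · by_contra h; exact hz (by rw [adjMat_of_not h, mul_zero])
        by_cases h1 : G.Adj u v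
        · have a1 : ¬ G.Adj p u := fun h => hvp (hd u huD v hvD p hpD h1 h.symm)
          have a2 : ¬ G.Adj q u := fun h => hvq (hd u huD v hvD q hqD h1 h.symm)
          rw [adjMat_of_not a1, adjMat_of_not a2, adjMat_of_adj h1,
            adjMat_of_adj (hHadj h1.ne (Or.inl h1))]
          norm_num
        · rw [adjMat_of_not h1, zero_add]
          by_cases h2 : G.Adj p u ∧ G.Adj q v
          · have a1 : ¬ G.Adj q u := fun h => hpqu u huD h2.1 h
            have huv : u ≠ v := by
              rintro rfl
              exact hpqu u huD h2.1 h2.2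
            rw [adjMat_of_adj h2.1, adjMat_of_adj h2.2, adjMat_of_not a1,
              adjMat_of_adj (hHadj huv (Or.inr (Or.inl h2)))]
            norm_num
          · have z1 : adjMat G p u * adjMat G q v = 0 := by
              by_cases h : G.Adj p u
              · rw [adjMat_of_not (fun h' => h2 ⟨h, h'⟩), mul_zero]
              · rw [adjMat_of_not h, zero_mul]
            rw [z1, zero_add]
            by_cases h3 : G.Adj q u ∧ G.Adj p v
            · have huv : u ≠ v := by
                rintro rfl
                exact hpqu u huD h3.2 h3.1
              rw [adjMat_of_adj h3.1, adjMat_of_adj h3.2,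
                adjMat_of_adj (hHadj huv (Or.inr (Or.inr h3)))]
              norm_num
            · have z2 : adjMat G q u * adjMat G p v = 0 := by
                by_cases h : G.Adj q u
                · rw [adjMat_of_not (fun h' => h3 ⟨h, h'⟩), mul_zero]
                · rw [adjMat_of_not h, zero_mul]
              rw [z2]
              exact adjMat_nonneg H u v
      have := mul_le_mul_of_nonneg_right hle (mul_pos (hx u) (hx v)).le
      refine le_trans (le_of_eq ?_) this
      ring
    rw [e1, e2, adjMat_of_adj hHpq, one_mul]
    by_cases hGpq : G.Adj p q
    · have hP0 : P = 0 := by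
        rw [hP]
        refine Finset.sum_eq_zero fun r hr => ?_
        have : ¬ G.Adj p r := fun h =>
          ((hmem r).1 hr).1 (hd p hpD r ((hmem r).1 hr).2.2 q hqD h hGpq)
        rw [adjMat_of_not this, zero_mul]
      have hQ0 : Q = 0 := by
        rw [hQ]
        refine Finset.sum_eq_zero fun r hr => ?_
        have : ¬ G.Adj q r := fun h =>
          ((hmem r).1 hr).2.1 (hd q hqD r ((hmem r).1 hr).2.2 p hpD h hGpq.symm)
        rw [adjMat_of_not this, zero_mul]
      rw [adjMat_of_adj hGpq, hP0, hQ0]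
      rw [hP0, hQ0] at hRR
      linarith
    · rw [adjMat_of_not hGpq]
      have := mul_nonneg (sub_nonneg.2 hQ1) (sub_nonneg.2 hP1)
      nlinarith
  linarith

end inequality

/-- For `φ > 2`, a graph with maximal spectral radius in `Bl(k,φ)` has a central
cut vertex: it has exactly one cut vertex, and this vertex lies in every block. -/
theorem maximal_has_central_cutVertex (k φ : ℕ) (hφ : 2 < φ)
    (G : SimpleGraph (Fin k)) (hG : MaxSpecIn k φ G) :
    ∃ c : Fin k, IsCutVertex G c ∧ (∀ v : Fin k, IsCutVertex G v → v = c) ∧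
      ∀ B : Set (Fin k), IsBlock G B → c ∈ B := by
  classical
  obtain ⟨⟨hB, hnum⟩, hmax⟩ := hG
  obtain ⟨x, hx⟩ := exists_perron G hB.1
  obtain ⟨D0, hD0, hcard0⟩ := exists_maxDissoc G
  obtain ⟨D, rfl⟩ : ∃ D : Finset (Fin k), (D : Set (Fin k)) = D0 :=
    ⟨D0.toFinset, by simp⟩
  have hcard : D.card = φ := by
    rw [← hnum, ← hcard0, Set.ncard_coe_finset]
  have hd := (dissoc_iff G D).1 hD0
  -- a non-adjacent pair
  have hnc : ∃ u v, u ≠ v ∧ ¬ G.Adj u v := by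
    by_contra hcon
    push Not at hcon
    have := clique_le_two hD0 subset_rfl fun u _ v _ huv => hcon u v huv
    rw [Set.ncard_coe_finset] at this
    omega
  -- the complement of D is nonempty
  have hS : (Dᶜ).Nonempty := by
    by_contra hcon
    rw [Finset.not_nonempty_iff_eq_empty, Finset.compl_eq_empty_iff] at hcon
    obtain ⟨a, b, c, ha, hb, hc', hab, hac, hbc⟩ := Finset.two_lt_card_iff.1 (hcard ▸ hφ)
    have hall : ∀ z, z ∈ (D : Set (Fin k)) := fun z => by simp [hcon]
    have key : ∀ (u v : Fin k) (p : G.Walk u v), u = v ∨ G.Adj u v := by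
      intro u v p
      induction p with
      | nil => exact Or.inl rfl
      | @cons u w v h q ih =>
        rcases ih with rfl | ih
        · exact Or.inr h
        · exact Or.inl (hd w (hall w) u (hall u) v (hall v) h.symm ih)
    obtain ⟨p1⟩ := hB.1.preconnected a b
    obtain ⟨p2⟩ := hB.1.preconnected a c
    have h1 := (key _ _ p1).resolve_left hab
    have h2 := (key _ _ p2).resolve_left hac
    exact hbc (hd a (hall a) b (hall b) c (hall c) h1 h2)
  obtain ⟨c, hcS, hcmax⟩ := Finset.exists_max_image Dᶜ x hS
  obtain ⟨p, hpD, hp⟩ := Finset.exists_max_image D x (Finset.card_pos.1 (by omega))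
  obtain ⟨q, hqD, hq⟩ := Finset.exists_max_image (D.erase p) x (Finset.card_pos.1 (by
    rw [Finset.card_erase_of_mem hpD]; omega))
  have hcD : c ∉ D := by simpa using hcS
  have hqD' := Finset.mem_of_mem_erase hqD
  have hpq : p ≠ q := (Finset.ne_of_mem_erase hqD).symm
  have hmem : memBl k φ (HG G D c p q) := by
    refine ⟨HG_block hD0 hpD hqD' hpq, ?_⟩
    rw [HG_dissocNum hD0 hpD hqD' hpq hcD, Set.ncard_coe_finset, hcard]
  have hle := qf_HG_ge hB D hD0 x hx.1 c p q hcD hpD hqD' hpq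
    (fun s hs => hcmax s (by simpa using hs)) hp
    (fun d hdD hdp => hq d (Finset.mem_erase.2 ⟨hdp, hdD⟩))
  exact ⟨c, central_of_dom hB c
    (dom_of_compare G _ x hx (hmax _ hmem) hle c (HG_dom G D c p q)) hnc⟩

end SpectralBlock
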